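/- Let M be a model of Vaught set theory VS. Then: (i) for every natural number n there exists x ∈ M having exactly n ∈-elements; (ii) for all natural numbers n, m, if x ∈ M has exactly n ∈-elements and y ∈ M has exactly m ∈-elements, then x ∼ y holds in M if and only if n = m. (This is the core of the theorem that VS interprets the theory R via a one-dimensional interpretation: the standardly finite sets serve as numerals.) -/

import Mathlib

/-!
Vaught set theory `VS`, semantically: a type `M` with a membership relation `mem`
satisfying (VS1) an empty set exists and (VS2ₙ, n ≥ 1) every nonempty finite
collection of elements is the extension of some element.
-/

namespace VS

variable {M : Type*}

/-- `p` is a (Kuratowski) pair-representative of `(u, v)`. -/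
def IsPairRep (mem : M → M → Prop) (p u v : M) : Prop :=
  ∃ a b : M, (∀ z, mem z p ↔ (z = a ∨ z = b)) ∧ (∀ z, mem z a ↔ z = u) ∧
    (∀ z, mem z b ↔ (z = u ∨ z = v))

/-- `f` is a function: all of its elements are pair-representatives, and any two
elements of `f` with the same first component are equal. -/
def IsFunc (mem : M → M → Prop) (f : M) : Prop :=
  (∀ w, mem w f → ∃ u v, IsPairRep mem w u v) ∧
  (∀ w w' u v u' v', mem w f → mem w' f → IsPairRep mem w u v → IsPairRep mem w' u' v' →
    u = u' → w = w')

/-- `f : x ∼ y`: `f` is a bijection between `x` and `y`. -/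
def IsBij (mem : M → M → Prop) (f x y : M) : Prop :=
  IsFunc mem f ∧
  (∀ w u v, mem w f → IsPairRep mem w u v → mem u x ∧ mem v y) ∧
  (∀ u, mem u x → ∃ w v, mem w f ∧ IsPairRep mem w u v) ∧
  (∀ v, mem v y → ∃ w u, mem w f ∧ IsPairRep mem w u v) ∧
  (∀ w w' u v u' v', mem w f → mem w' f → IsPairRep mem w u v → IsPairRep mem w' u' v' →
    v = v' → w = w')

/-- `x ∼ y`: there is a bijection between `x` and `y`. -/
def Sim (mem : M → M → Prop) (x y : M) : Prop := ∃ f, IsBij mem f x y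

/-- The class `PC₀`. -/
def PC0 (mem : M → M → Prop) (x : M) : Prop :=
  Sim mem x x ∧ (∀ y z, Sim mem x y → Sim mem x z → Sim mem y z) ∧
  (∀ y z, Sim mem x y → Sim mem y z → Sim mem x z)

/-- The class `PC₁`. -/
def PC1 (mem : M → M → Prop) (x : M) : Prop :=
  PC0 mem x ∧ ∀ u v f, Sim mem x u → Sim mem u v → IsBij mem f u v → Sim mem u f

/-- The reinterpreted membership relation `∈⁺`: `u ∈⁺ v` iff `u ∈ v` and `PC₁(v)`. -/
def memPlus (mem : M → M → Prop) (u v : M) : Prop := mem u v ∧ PC1 mem v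

/-- The axioms of Vaught set theory `VS`: (VS1) there is an empty set, and
(VS2ₙ for n ≥ 1) any nonempty finite list of elements is the extension of some element. -/
def VSAx (mem : M → M → Prop) : Prop :=
  (∃ x, ∀ y, ¬ mem y x) ∧
  (∀ l : List M, l ≠ [] → ∃ x, ∀ y, mem y x ↔ y ∈ l)

end VS

namespace VS

/-- `x` has exactly `n` `∈`-elements. -/
def HasCard {M : Type*} (mem : M → M → Prop) (x : M) (n : ℕ) : Prop :=
  ∃ s : Finset M, s.card = n ∧ ∀ y, mem y x ↔ y ∈ s

end VS

namespace VS

variable {M : Type*} {mem : M → M → Prop}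

theorem VSAx.exists_extension (h : VSAx mem) (s : Finset M) : ∃ x, ∀ y, mem y x ↔ y ∈ s := by
  rcases s.eq_empty_or_nonempty with rfl | hs
  · simpa using h.1
  · simpa using h.2 s.toList (by simpa using hs.ne_empty)

theorem VSAx.infinite (h : VSAx mem) : Infinite M := by
  by_contra hM
  rw [not_infinite_iff_finite] at hM
  choose g hg using fun s : Set M => h.exists_extension s.toFinite.toFinset
  refine Function.cantor_injective g fun s t hst => ?_
  ext y
  have hs := hg s y
  have ht := hg t y
  rw [hst] at hs
  simpa using hs.symm.trans ht

theorem VSAx.exists_isPairRep (h : VSAx mem) (u v : M) : ∃ p, IsPairRep mem p u v := by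
  obtain ⟨a, ha⟩ := h.2 [u] (by simp)
  obtain ⟨b, hb⟩ := h.2 [u, v] (by simp)
  obtain ⟨p, hp⟩ := h.2 [a, b] (by simp)
  exact ⟨p, a, b, by simpa using hp, by simpa using ha, by simpa using hb⟩

theorem IsPairRep.ext {p u v u' v' : M} (hp : IsPairRep mem p u v)
    (hp' : IsPairRep mem p u' v') : u = u' ∧ v = v' := by
  obtain ⟨a, b, hab, ha, hb⟩ := hp
  obtain ⟨a', b', hab', ha', hb'⟩ := hp'
  have hu : u = u' := by
    have := (hab' a).1 ((hab a).2 (Or.inl rfl))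
    have hua := (ha u).2 rfl
    have hua' := (ha' u').2 rfl
    have hub' := (hb' u').2 (Or.inl rfl)
    grind
  have hv : v = u' ∨ v = v' := by
    have := (hab' b).1 ((hab b).2 (Or.inr rfl))
    have hvb := (hb v).2 (Or.inr rfl)
    grind
  have hv' : v' = u ∨ v' = v := by
    have := (hab b').1 ((hab' b').2 (Or.inr rfl))
    have hvb' := (hb' v').2 (Or.inr rfl)
    grind
  grind

theorem IsBij.card_eq {f x y : M} {s t : Finset M} (hf : IsBij mem f x y)
    (hs : ∀ z, mem z x ↔ z ∈ s) (ht : ∀ z, mem z y ↔ z ∈ t) : s.card = t.card := by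
  obtain ⟨⟨-, huniq⟩, hmem, htot, hsurj, hinj⟩ := hf
  choose w g hw hwg using fun (u : M) (hu : u ∈ s) => htot u ((hs u).2 hu)
  refine Finset.card_bij g (fun u hu => (ht _).1 (hmem _ _ _ (hw u hu) (hwg u hu)).2) ?_ ?_
  · intro u hu u' hu' hg
    have hww := hinj _ _ _ _ _ _ (hw u hu) (hw u' hu') (hwg u hu) (hwg u' hu') hg
    exact ((hww ▸ hwg u hu).ext (hwg u' hu')).1
  · intro v hv
    obtain ⟨p, u, hp, hpuv⟩ := hsurj v ((ht v).2 hv)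
    have hu := (hs u).1 (hmem _ _ _ hp hpuv).1
    have hpw := huniq _ _ _ _ _ _ (hw u hu) hp (hwg u hu) hpuv rfl
    exact ⟨u, hu, ((hpw ▸ hwg u hu).ext hpuv).2⟩

theorem VSAx.sim_of_card_eq (h : VSAx mem) {x y : M} {s t : Finset M}
    (hs : ∀ z, mem z x ↔ z ∈ s) (ht : ∀ z, mem z y ↔ z ∈ t) (hst : s.card = t.card) :
    Sim mem x y := by
  classical
  let e : s ≃ t := Finset.equivOfCardEq hst
  choose w hw using fun u : s => h.exists_isPairRep (u : M) (e u)
  obtain ⟨f, hf⟩ := h.exists_extension (Finset.univ.image w)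
  have hmem : ∀ p, mem p f ↔ ∃ u, w u = p := by simpa using hf
  have hcomp : ∀ {p u v}, mem p f → IsPairRep mem p u v →
      ∃ i : s, w i = p ∧ (i : M) = u ∧ (e i : M) = v := by
    intro p u v hp hpuv
    obtain ⟨i, rfl⟩ := (hmem p).1 hp
    exact ⟨i, rfl, (hw i).ext hpuv⟩
  refine ⟨f, ⟨fun p hp => ?_, ?_⟩, ?_, ?_, ?_, ?_⟩
  · obtain ⟨i, rfl⟩ := (hmem p).1 hp
    exact ⟨_, _, hw i⟩
  · intro p p' u v u' v' hp hp' hr hr' huu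
    obtain ⟨i, rfl, rfl, rfl⟩ := hcomp hp hr
    obtain ⟨j, rfl, rfl, rfl⟩ := hcomp hp' hr'
    rw [Subtype.ext huu]
  · intro p u v hp hr
    obtain ⟨i, -, rfl, rfl⟩ := hcomp hp hr
    exact ⟨(hs _).2 i.2, (ht _).2 (e i).2⟩
  · intro u hu
    exact ⟨_, _, (hmem _).2 ⟨⟨u, (hs u).1 hu⟩, rfl⟩, hw _⟩
  · intro v hv
    refine ⟨_, e.symm ⟨v, (ht v).1 hv⟩, (hmem _).2 ⟨e.symm ⟨v, (ht v).1 hv⟩, rfl⟩, ?_⟩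
    simpa using hw (e.symm ⟨v, (ht v).1 hv⟩)
  · intro p p' u v u' v' hp hp' hr hr' hvv
    obtain ⟨i, rfl, rfl, rfl⟩ := hcomp hp hr
    obtain ⟨j, rfl, rfl, rfl⟩ := hcomp hp' hr'
    rw [e.injective (Subtype.ext hvv)]

end VS

open VS in
/-- In a model of `VS`: for every `n` there is an element with exactly `n` `∈`-elements,
and two elements with exactly `n` resp. `m` `∈`-elements are `∼`-equivalent iff `n = m`. -/
theorem finite_numerals {M : Type*} (mem : M → M → Prop) (h : VSAx mem) :
    (∀ n : ℕ, ∃ x : M, HasCard mem x n) ∧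
    (∀ (n m : ℕ) (x y : M), HasCard mem x n → HasCard mem y m → (Sim mem x y ↔ n = m)) := by
  refine ⟨fun n => ?_, ?_⟩
  · have := h.infinite
    obtain ⟨s, hs⟩ := Infinite.exists_subset_card_eq M n
    obtain ⟨x, hx⟩ := h.exists_extension s
    exact ⟨x, s, hs, hx⟩
  · rintro n m x y ⟨s, rfl, hs⟩ ⟨t, rfl, ht⟩
    exact ⟨fun ⟨_, hf⟩ => hf.card_eq hs ht, h.sim_of_card_eq hs ht⟩
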